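/- There exists a constant c such that for all strings x and y: |K(x, K(x | y) | y) − K(x | y)| ≤ c; that is, K(x, K(x | y) | y) = K(x | y) + O(1) (complexity self-sufficiency). -/

import Mathlib

open scoped Classical ENNReal

/-- Binary strings. -/
abbrev BStr := List Bool

/-- Plain Kolmogorov complexity of `x` with respect to a decompressor `D`
(a partial function from binary strings to binary strings):
the minimal length of a description `p` with `D p = x`. -/
noncomputable def plainC (D : BStr →. BStr) (x : BStr) : ℕ :=
  sInf {n | ∃ p : BStr, p.length = n ∧ x ∈ D p}

/-- Conditional complexity of `x` given `y` with respect to a two-argument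
decompressor `D` (first argument: program, second: condition). -/
noncomputable def condC (D : BStr → BStr →. BStr) (x y : BStr) : ℕ :=
  sInf {n | ∃ p : BStr, p.length = n ∧ x ∈ D p y}

/-- A fixed computable encoding of natural numbers as binary strings. -/
def natStr (n : ℕ) : BStr := Nat.bits n

/-- A fixed computable pairing function on binary strings. -/
def pairStr (x y : BStr) : BStr := natStr (Encodable.encode (x, y))

/-- A fixed computable encoding of triples of binary strings. -/
def tripStr (x y z : BStr) : BStr := natStr (Encodable.encode (x, y, z))

/-- An optimal (universal) plain decompressor `V`: a partial computable
decompressor whose complexity function is minimal up to an additive constant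
among all partial computable decompressors. -/
structure OptimalDecompressor where
  V : BStr →. BStr
  partrec : Partrec V
  onto : ∀ x : BStr, ∃ p : BStr, x ∈ V p
  optimal : ∀ D : BStr →. BStr, Partrec D → ∃ M : ℕ, ∀ x : BStr,
    (∃ p : BStr, x ∈ D p) → plainC V x ≤ plainC D x + M

/-- A universal two-argument decompressor for conditional plain complexity. -/
structure CondOptimalDecompressor where
  Vc : BStr → BStr →. BStr
  partrec : Partrec₂ Vc
  onto : ∀ x y : BStr, ∃ p : BStr, x ∈ Vc p y
  optimal : ∀ D : BStr → BStr →. BStr, Partrec₂ D → ∃ M : ℕ, ∀ x y : BStr,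
    (∃ p : BStr, x ∈ D p y) → condC Vc x y ≤ condC D x y + M

/-- A two-argument decompressor is prefix-free if for each condition `y`
its domain (in the program argument) is prefix-free. -/
def PrefixFreeDom (D : BStr → BStr →. BStr) : Prop :=
  ∀ y p q : BStr, (D p y).Dom → (D q y).Dom → p <+: q → p = q

/-- A universal prefix-free conditional decompressor, defining conditional
prefix complexity `K(x | y)`. -/
structure UniversalPrefixDecompressor where
  D : BStr → BStr →. BStr
  partrec : Partrec₂ D
  prefixFree : PrefixFreeDom D
  onto : ∀ x y : BStr, ∃ p : BStr, x ∈ D p y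
  universal : ∀ D' : BStr → BStr →. BStr, Partrec₂ D' → PrefixFreeDom D' →
    ∃ c : ℕ, ∀ x y : BStr, (∃ p : BStr, x ∈ D' p y) →
      condC D x y ≤ condC D' x y + c

/-- Conditional prefix complexity `K(x | y)` with respect to a universal
prefix-free conditional decompressor `U`. -/
noncomputable def K (U : UniversalPrefixDecompressor) (x y : BStr) : ℕ := condC U.D x y

/-- The canonical enumeration of all pairs `(x, k)` with `C_V(x) ≤ k`,
obtained by dovetailing the computations of `V` on all programs: a computable
listing whose range is exactly the set of such pairs. -/
structure CanonicalEnum (V : BStr →. BStr) where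
  e : ℕ → Option (BStr × ℕ)
  computable : Computable e
  mem_iff : ∀ x : BStr, ∀ k : ℕ, (∃ t, e t = some (x, k)) ↔ plainC V x ≤ k

/-- The moment of first appearance of string `x` in the canonical enumeration
as a pair `(x, k)` with `k ≤ n`. -/
noncomputable def strFirst {V : BStr →. BStr} (E : CanonicalEnum V) (x : BStr) (n : ℕ) : ℕ :=
  sInf {t | ∃ k ≤ n, E.e t = some (x, k)}

/-- `w` is the last string of complexity at most `n` (i.e. `w = w_n`):
it has `C_V(w) ≤ n` and every string of complexity at most `n` appears
(as a pair with bound `≤ n`) no later than `w` does. -/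
def IsLastSimple (O : OptimalDecompressor) (E : CanonicalEnum O.V) (n : ℕ) (w : BStr) : Prop :=
  plainC O.V w ≤ n ∧ ∀ x : BStr, plainC O.V x ≤ n → strFirst E x n ≤ strFirst E w n

/-- The extension set `T_t(y) = { s : C_V(y, s) ≤ 2^t }`. -/
def Tset (O : OptimalDecompressor) (t : ℕ) (y : BStr) : Set BStr :=
  {s | plainC O.V (pairStr y s) ≤ 2 ^ t}

/-- The relaxed extension set `T_t^δ(y) = { s : C_V(y, s) ≤ 2^t + δ }`. -/
def TsetR (O : OptimalDecompressor) (t δ : ℕ) (y : BStr) : Set BStr :=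
  {s | plainC O.V (pairStr y s) ≤ 2 ^ t + δ}

/-- The "past" set `St^w_t(y)`: extensions `s` with `C_V(y, s) ≤ 2^t` whose
pair appears in the canonical enumeration (with bound `≤ 2^t`) strictly
before `w = w_n` appears (with bound `≤ n`). -/
def StSet (O : OptimalDecompressor) (E : CanonicalEnum O.V) (t n : ℕ) (w : BStr)
    (y : BStr) : Set BStr :=
  {s | plainC O.V (pairStr y s) ≤ 2 ^ t ∧
       strFirst E (pairStr y s) (2 ^ t) < strFirst E w n}

/-- The tower sequence `a_0 = 1`, `a_{i+1} = 2^{a_i}`. -/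
def tower : ℕ → ℕ
  | 0 => 1
  | i + 1 => 2 ^ tower i

/-- `qt` is a structural witness for `q` relative to `n` with constant `c₀`:
it is short, effectively encodes `q`, and satisfies the complexity
decomposition `K(q̃ | n) = K(q̃, α, K(q̃, α | q) | n) + O(1)` where `α = K(q̃ | n)`. -/
def StructuralWitness (Oc : CondOptimalDecompressor) (U : UniversalPrefixDecompressor)
    (c₀ n q : ℕ) (qt : BStr) : Prop :=
  qt.length ≤ c₀ * Nat.log 2 q ∧
  condC Oc.Vc (natStr q) qt ≤ c₀ ∧
  K U qt (natStr n) ≤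
      K U (tripStr qt (natStr (K U qt (natStr n)))
        (natStr (K U (pairStr qt (natStr (K U qt (natStr n)))) (natStr q)))) (natStr n) + c₀ ∧
  K U (tripStr qt (natStr (K U qt (natStr n)))
        (natStr (K U (pairStr qt (natStr (K U qt (natStr n)))) (natStr q)))) (natStr n) ≤
      K U qt (natStr n) + c₀


theorem natStr_primrec : Primrec natStr := by
  have h : Primrec₂ (fun (_ : Unit) (n : ℕ) => natStr n) := by
    refine Primrec.nat_strong_rec (fun (_ : Unit) (n : ℕ) => natStr n)
      (g := fun _ (l : List BStr) =>
        if l.length = 0 then some [] else (l[l.length.div2]?).map (fun t => l.length.bodd :: t))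
      ?_ ?_
    · refine Primrec.ite ?_ (Primrec.const _) ?_
      · exact Primrec.eq.comp (Primrec.list_length.comp Primrec.snd) (Primrec.const 0)
      · refine Primrec.option_map ?_ ?_
        · exact Primrec.list_getElem?.comp Primrec.snd
            (Primrec.nat_div2.comp (Primrec.list_length.comp Primrec.snd))
        · exact Primrec.list_cons.comp
            (Primrec.nat_bodd.comp (Primrec.list_length.comp (Primrec.snd.comp Primrec.fst)))
            Primrec.snd
    · intro _ n
      rcases Nat.eq_zero_or_pos n with rfl | hn
      · simp [natStr]
      · have h1 : n.div2 < n := Nat.binaryRec_decreasing (by omega)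
        have h2 : natStr n = n.bodd :: natStr n.div2 := by
          unfold natStr
          conv_lhs => rw [← Nat.bit_bodd_div2 n]
          refine Nat.bits_append_bit _ _ ?_
          intro h0
          have := Nat.bodd_add_div2 n
          rw [h0] at this
          cases hb : n.bodd
          · simp [hb] at this; omega
          · rfl
        simp [h2, h1, Nat.pos_iff_ne_zero.mp hn]
  exact h.comp (Primrec.const ()) Primrec.id

/-- Left inverse of `natStr`. -/
def strNat (l : BStr) : ℕ := l.foldr (fun b n => Nat.bit b n) 0

theorem strNat_natStr (n : ℕ) : strNat (natStr n) = n := by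
  induction n using Nat.binaryRec' with
  | zero => simp [natStr, strNat]
  | bit b n h ih =>
    have : natStr (Nat.bit b n) = b :: natStr n := Nat.bits_append_bit _ _ h
    rw [this]
    simp only [strNat, List.foldr_cons] at ih ⊢
    rw [ih]

theorem strNat_primrec : Primrec strNat := by
  have h : Primrec (fun q : Bool × ℕ => Nat.bit q.1 q.2) := by
    have : Primrec (fun q : Bool × ℕ => bif q.1 then 2 * q.2 + 1 else 2 * q.2) := by
      have h2 : Primrec (fun q : Bool × ℕ => 2 * q.2) :=
        Primrec.nat_mul.comp (Primrec.const 2) Primrec.snd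
      exact Primrec.cond Primrec.fst (Primrec.succ.comp h2) h2
    refine this.of_eq ?_
    rintro ⟨b, n⟩
    cases b <;> simp [Nat.bit]
  exact Primrec.list_foldr (α := BStr) (β := Bool) (σ := ℕ) (f := fun l => l)
    (g := fun _ => 0) (h := fun _ q => Nat.bit q.1 q.2)
    Primrec.id (Primrec.const 0) (h.comp Primrec.snd)

/-- Decompressor outputting the pair (output, program length). -/
def decPair (D : BStr → BStr →. BStr) (p y : BStr) : Part BStr :=
  (D p y).map (fun z => pairStr z (natStr p.length))

/-- Decompressor outputting the first component. -/
def decFst (D : BStr → BStr →. BStr) (p y : BStr) : Part BStr :=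
  (D p y).bind (fun z =>
    ((Encodable.decode (α := BStr × BStr) (strNat z)).map Prod.fst : Option BStr))

theorem decPair_partrec {D : BStr → BStr →. BStr} (h : Partrec₂ D) : Partrec₂ (decPair D) := by
  refine Partrec.map h ?_
  refine Primrec.to_comp ?_
  refine natStr_primrec.comp (Primrec.encode.comp (Primrec.pair Primrec.snd ?_))
  exact natStr_primrec.comp (Primrec.list_length.comp (Primrec.fst.comp Primrec.fst))

theorem decFst_partrec {D : BStr → BStr →. BStr} (h : Partrec₂ D) : Partrec₂ (decFst D) := by
  refine Partrec.bind h ?_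
  refine Computable.ofOption (Primrec.to_comp ?_)
  exact Primrec.option_map (Primrec.decode.comp (strNat_primrec.comp Primrec.snd))
    (Primrec.fst.comp Primrec.snd)

theorem prefixFree_mono {D D' : BStr → BStr →. BStr} (h : PrefixFreeDom D)
    (hd : ∀ p y, (D' p y).Dom → (D p y).Dom) : PrefixFreeDom D' :=
  fun y p q hp hq hpq => h y p q (hd p y hp) (hd q y hq) hpq

theorem condC_le {D : BStr → BStr →. BStr} {x y p : BStr} (h : x ∈ D p y) :
    condC D x y ≤ p.length := Nat.sInf_le ⟨p, rfl, h⟩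

theorem condC_attained {D : BStr → BStr →. BStr} {x y : BStr} (h : ∃ p, x ∈ D p y) :
    ∃ p, p.length = condC D x y ∧ x ∈ D p y := by
  obtain ⟨p, hp⟩ := h
  exact Nat.sInf_mem (s := {n | ∃ p : BStr, p.length = n ∧ x ∈ D p y}) ⟨_, p, rfl, hp⟩

/-- Complexity self-sufficiency: there is a constant `c` such
that for all strings `x, y`: `|K(x, K(x | y) | y) − K(x | y)| ≤ c`. -/
theorem complexity_self_sufficiency (U : UniversalPrefixDecompressor) :
    ∃ c : ℕ, ∀ x y : BStr,
      K U (pairStr x (natStr (K U x y))) y ≤ K U x y + c ∧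
      K U x y ≤ K U (pairStr x (natStr (K U x y))) y + c := by
  obtain ⟨c₁, h₁⟩ := U.universal (decPair U.D) (decPair_partrec U.partrec)
    (prefixFree_mono U.prefixFree (fun p y h => h))
  obtain ⟨c₂, h₂⟩ := U.universal (decFst U.D) (decFst_partrec U.partrec)
    (prefixFree_mono U.prefixFree (fun p y h => (Part.bind_dom.mp h).1))
  refine ⟨c₁ + c₂, fun x y => ⟨?_, ?_⟩⟩
  · obtain ⟨p, hp, hx⟩ := condC_attained (U.onto x y)
    have hm : pairStr x (natStr (K U x y)) ∈ decPair U.D p y := by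
      have := Part.mem_map (fun z => pairStr z (natStr p.length)) hx
      rw [hp] at this
      unfold decPair
      rw [hp]
      exact this
    have a := h₁ _ y ⟨p, hm⟩
    have b := condC_le hm
    unfold K at *
    omega
  · obtain ⟨p, hp, hx⟩ := condC_attained (U.onto (pairStr x (natStr (K U x y))) y)
    have hm : x ∈ decFst U.D p y := by
      refine Part.mem_bind hx ?_
      simp [pairStr, strNat_natStr]
    have a := h₂ _ y ⟨p, hm⟩
    have b := condC_le hm
    unfold K at *
    omega
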